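/- arXiv:1903.02173 — 2 statements merged into one kernel-verified Lean document; each statement's English description precedes it below -/
import Mathlib

section
/- Let E be a real inner product space, S ⊆ E, K ≥ 0 and ξ̂ > 0. Let h_1, h_2, … : E → ℝ each be K-Lipschitz on S, and define H_n = (1/n) Σ_{t=1}^{n} h_t. Let T ≥ 2, suppose x ↦ H_{T−1}(x) − ξ̂ ‖x‖² is convex on E, and suppose D_T ∈ S is a global minimizer of H_T and D_{T−1} ∈ S is a global minimizer of H_{T−1}. Then ‖D_T − D_{T−1}‖ ≤ 2K/(ξ̂ T). (Proposition 2: the library D converges asymptotically to a stationary point with successive-iterate differences of order O(1/T), stated in its quantitative form ‖D_T − D_{T−1}‖_F ≤ ξ_T/ξ̂ with ξ_T = O(1/T).) -/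
theorem stmt8 (E : Type*) [NormedAddCommGroup E] [InnerProductSpace ℝ E]
    (S : Set E) (K ξ : ℝ) (hK : 0 ≤ K) (hξ : 0 < ξ)
    (h : ℕ → E → ℝ)
    (hlip : ∀ t, ∀ x ∈ S, ∀ y ∈ S, |h t x - h t y| ≤ K * ‖x - y‖)
    (H : ℕ → E → ℝ)
    (hH : ∀ n x, H n x = (1 / (n : ℝ)) * ∑ t ∈ Finset.range n, h t x)
    (T : ℕ) (hT : 2 ≤ T)
    (hconv : ConvexOn ℝ Set.univ (fun x => H (T - 1) x - ξ * ‖x‖ ^ 2))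
    (DT : E) (hDT : DT ∈ S) (hminT : ∀ x, H T DT ≤ H T x)
    (DT1 : E) (hDT1 : DT1 ∈ S) (hminT1 : ∀ x, H (T - 1) DT1 ≤ H (T - 1) x) :
    ‖DT - DT1‖ ≤ 2 * K / (ξ * T) := by
  obtain ⟨n, rfl⟩ : ∃ n, T = n + 1 := ⟨T - 1, by omega⟩
  simp only [Nat.add_sub_cancel] at hconv hminT1
  have hn : (1 : ℝ) ≤ n := by
    have : 1 ≤ n := by omega
    exact_mod_cast this
  set d := ‖DT - DT1‖ with hd
  have hd0 : 0 ≤ d := norm_nonneg _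
  have key : ∀ s : ℝ, 0 < s → s < 1 → (1 - s) * (ξ * d ^ 2) ≤ H n DT - H n DT1 := by
    intro s hs0 hs1
    have h1 := hconv.2 (Set.mem_univ DT1) (Set.mem_univ DT)
      (by linarith : (0:ℝ) ≤ 1 - s) hs0.le (by ring)
    have h2 := hminT1 ((1 - s) • DT1 + s • DT)
    have h3 : ‖(1 - s) • DT1 + s • DT‖ ^ 2
        = (1 - s) * ‖DT1‖ ^ 2 + s * ‖DT‖ ^ 2 - s * (1 - s) * d ^ 2 := by
      rw [hd, norm_add_sq_real, norm_sub_sq_real, norm_smul, norm_smul, inner_smul_left,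
        inner_smul_right, real_inner_comm DT DT1, mul_pow, mul_pow, Real.norm_eq_abs,
        Real.norm_eq_abs, sq_abs, sq_abs]
      simp only [conj_trivial]
      ring
    simp only [smul_eq_mul] at h1
    rw [h3] at h1
    have h4 : s * ((1 - s) * (ξ * d ^ 2)) ≤ s * (H n DT - H n DT1) := by linarith
    exact le_of_mul_le_mul_left h4 hs0
  have hΔ : 0 ≤ H n DT - H n DT1 := by linarith [hminT1 DT]
  have key2 : ξ * d ^ 2 ≤ H n DT - H n DT1 := by
    by_contra! hc
    have hA : 0 < ξ * d ^ 2 := by linarith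
    have h5 := key ((ξ * d ^ 2 - (H n DT - H n DT1)) / (2 * (ξ * d ^ 2)))
      (by apply div_pos <;> linarith) (by rw [div_lt_one] <;> linarith)
    rw [sub_mul, div_mul_eq_mul_div, mul_div_mul_right _ _ hA.ne'] at h5
    linarith
  have hl := hlip n DT hDT DT1 hDT1
  have hm := hminT DT1
  have e1 : ∀ x, (n : ℝ) * H n x = ∑ t ∈ Finset.range n, h t x := by
    intro x
    rw [hH]
    field_simp
  have e2 : ∀ x, ((n : ℝ) + 1) * H (n + 1) x = ∑ t ∈ Finset.range n, h t x + h n x := by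
    intro x
    rw [hH, Finset.sum_range_succ]
    push_cast
    field_simp
  have hm2 : ((n : ℝ) + 1) * H (n + 1) DT ≤ ((n : ℝ) + 1) * H (n + 1) DT1 :=
    mul_le_mul_of_nonneg_left hm (by linarith)
  rw [e2, e2, ← e1, ← e1] at hm2
  have hub : (n : ℝ) * (H n DT - H n DT1) ≤ K * d := by
    have := (abs_le.1 hl).1
    linarith
  have hfin : n * (ξ * d ^ 2) ≤ K * d :=
    (mul_le_mul_of_nonneg_left key2 (by linarith)).trans hub
  push_cast
  rw [le_div_iff₀ (by positivity)]
  rcases hd0.eq_or_lt with h0 | h0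
  · rw [← h0]; linarith
  · have h6 : n * (ξ * d) ≤ K := by
      refine le_of_mul_le_mul_right ?_ h0
      linarith
    have h7 : 0 ≤ (n - 1) * (ξ * d) := mul_nonneg (by linarith) (by positivity)
    linarith
end

section
/- Let p, d ≥ 1, B > 0, R > 0, μ > 0, and let w_1, w_2, … ∈ ℝ^d and c_1, c_2, … ∈ ℝ^p satisfy ‖w_t‖₂ ≤ B and ‖c_t‖₂ ≤ B for all t. For each n ≥ 1 define H_n : ℝ^{p×d} → ℝ by H_n(L) = (1/n) Σ_{t=1}^{n} ‖c_t − L w_t‖₂². Let T ≥ 2, suppose the smallest eigenvalue of the matrix (1/(T−1)) Σ_{t=1}^{T−1} w_t w_tᵀ is at least μ, and suppose L_T and L_{T−1} are global minimizers of H_T and H_{T−1} respectively, both with Frobenius norm at most R. Then ‖L_T − L_{T−1}‖_F ≤ 4 B² (1 + R) / (μ T). (Proposition 3: the encoding matrix L converges asymptotically to a stationary point with convergence rate O(1/T), stated in quantitative form for the least-squares subproblem Eq. (19).) -/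
open Matrix Finset

lemma aux_quad (a b : ℝ) (ha : 0 ≤ a) (h : ∀ s : ℝ, 0 ≤ a * s ^ 2 - 2 * b * s) : b = 0 := by
  have h1 := h (b / (a + 1))
  have hp : 0 < a + 1 := by linarith
  have e : a * (b / (a + 1)) ^ 2 - 2 * b * (b / (a + 1)) = -(b ^ 2 * (a + 2)) / (a + 1) ^ 2 := by
    field_simp
    ring
  rw [e, le_div_iff₀ (by positivity)] at h1
  have : b ^ 2 = 0 := by nlinarith [sq_nonneg b, mul_nonneg (sq_nonneg b) ha]
  exact pow_eq_zero_iff (two_ne_zero) |>.1 this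

lemma aux_first {p d : ℕ} (w : ℕ → Fin d → ℝ) (c : ℕ → Fin p → ℝ) (n : ℕ) (hn : 0 < n)
    (L0 D : Matrix (Fin p) (Fin d) ℝ)
    (h : ∀ L : Matrix (Fin p) (Fin d) ℝ,
      (1 / (n : ℝ)) * ∑ t ∈ Finset.range n, ∑ i, (c t i - L0.mulVec (w t) i) ^ 2 ≤
      (1 / (n : ℝ)) * ∑ t ∈ Finset.range n, ∑ i, (c t i - L.mulVec (w t) i) ^ 2) :
    ∑ t ∈ Finset.range n, ∑ i, (c t i - L0.mulVec (w t) i) * D.mulVec (w t) i = 0 := by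
  apply aux_quad (∑ t ∈ Finset.range n, ∑ i, (D.mulVec (w t) i) ^ 2)
  · positivity
  · intro s
    have hn' : (0 : ℝ) < 1 / (n : ℝ) := by positivity
    have h1 := le_of_mul_le_mul_left (h (L0 + s • D)) hn'
    have e : ∑ t ∈ Finset.range n, ∑ i, (c t i - (L0 + s • D).mulVec (w t) i) ^ 2
        = ∑ t ∈ Finset.range n, ∑ i, (c t i - L0.mulVec (w t) i) ^ 2
          + ((∑ t ∈ Finset.range n, ∑ i, (D.mulVec (w t) i) ^ 2) * s ^ 2
          - 2 * (∑ t ∈ Finset.range n, ∑ i, (c t i - L0.mulVec (w t) i) * D.mulVec (w t) i) * s) := by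
      simp only [Finset.sum_mul, Finset.mul_sum, ← Finset.sum_sub_distrib, ← Finset.sum_add_distrib]
      refine Finset.sum_congr rfl fun t _ => Finset.sum_congr rfl fun i _ => ?_
      simp only [Matrix.add_mulVec, Matrix.smul_mulVec, Pi.add_apply, Pi.smul_apply, smul_eq_mul]
      ring
    linarith

lemma aux_mulVec {p d : ℕ} (D : Matrix (Fin p) (Fin d) ℝ) (v : Fin d → ℝ) :
    ∑ i, (D.mulVec v i) ^ 2 ≤ (∑ i, ∑ j, (D i j) ^ 2) * ∑ j, (v j) ^ 2 := by
  rw [Finset.sum_mul]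
  refine Finset.sum_le_sum fun i _ => ?_
  exact Finset.sum_mul_sq_le_sq_mul_sq Finset.univ (D i) v

lemma aux_cs {p : ℕ} (x y : Fin p → ℝ) (a b : ℝ) (ha : 0 ≤ a) (hb : 0 ≤ b)
    (hx : ∑ i, (x i) ^ 2 ≤ a ^ 2) (hy : ∑ i, (y i) ^ 2 ≤ b ^ 2) :
    |∑ i, x i * y i| ≤ a * b := by
  apply abs_le_of_sq_le_sq _ (by positivity)
  calc _ ≤ _ := Finset.sum_mul_sq_le_sq_mul_sq _ _ _
    _ ≤ a ^ 2 * b ^ 2 := by gcongr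
    _ = _ := by ring

lemma aux_quadform {d : ℕ} (w : ℕ → Fin d → ℝ) (n : ℕ) (k : ℝ) (v : Fin d → ℝ) :
    v ⬝ᵥ ((k • ∑ t ∈ Finset.range n, Matrix.vecMulVec (w t) (w t)).mulVec v)
      = k * ∑ t ∈ Finset.range n, (v ⬝ᵥ w t) ^ 2 := by
  rw [Matrix.smul_mulVec, dotProduct_smul, smul_eq_mul, Matrix.sum_mulVec, dotProduct_sum]
  congr 1
  refine Finset.sum_congr rfl fun t _ => ?_
  rw [Matrix.vecMulVec_mulVec, dotProduct_comm (w t) v]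
  simp [dotProduct_smul, sq]

theorem stmt9 (p d : ℕ) (hp : 1 ≤ p) (hd : 1 ≤ d) (B R μ : ℝ)
    (hB : 0 < B) (hR : 0 < R) (hμ : 0 < μ)
    (w : ℕ → Fin d → ℝ) (c : ℕ → Fin p → ℝ)
    (hw : ∀ t, Real.sqrt (∑ i, (w t i) ^ 2) ≤ B)
    (hc : ∀ t, Real.sqrt (∑ i, (c t i) ^ 2) ≤ B)
    (H : ℕ → Matrix (Fin p) (Fin d) ℝ → ℝ)
    (hH : ∀ n L, H n L
      = (1 / (n : ℝ)) * ∑ t ∈ Finset.range n, ∑ i, (c t i - L.mulVec (w t) i) ^ 2)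
    (T : ℕ) (hT : 2 ≤ T)
    (heig : ∀ v : Fin d → ℝ,
      μ * ∑ i, (v i) ^ 2
        ≤ v ⬝ᵥ (((1 / ((T : ℝ) - 1)) •
            ∑ t ∈ Finset.range (T - 1), Matrix.vecMulVec (w t) (w t)).mulVec v))
    (LT LT1 : Matrix (Fin p) (Fin d) ℝ)
    (hLT : ∀ L, H T LT ≤ H T L)
    (hLT1 : ∀ L, H (T - 1) LT1 ≤ H (T - 1) L)
    (hLTn : Real.sqrt (∑ i, ∑ j, (LT i j) ^ 2) ≤ R)
    (hLT1n : Real.sqrt (∑ i, ∑ j, (LT1 i j) ^ 2) ≤ R) :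
    Real.sqrt (∑ i, ∑ j, (LT i j - LT1 i j) ^ 2) ≤ 4 * B ^ 2 * (1 + R) / (μ * T) := by
  obtain ⟨n, rfl⟩ : ∃ n, T = n + 1 := ⟨T - 1, by omega⟩
  have hn : 0 < n := by omega
  have hnR : (1 : ℝ) ≤ n := by exact_mod_cast hn
  simp only [Nat.add_sub_cancel] at *
  push_cast at *
  simp only [hH] at hLT hLT1
  have f1 := aux_first w c (n + 1) (by omega) LT (LT - LT1) hLT
  have f2 := aux_first w c n hn LT1 (LT - LT1) hLT1
  set D := LT - LT1 with hD
  set N := Real.sqrt (∑ i, ∑ j, (LT i j - LT1 i j) ^ 2) with hN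
  have hN0 : 0 ≤ N := Real.sqrt_nonneg _
  have hN2 : ∑ i, ∑ j, (D i j) ^ 2 = N ^ 2 := by
    rw [hN, Real.sq_sqrt (by positivity)]
    rfl
  have e2 : ∑ t ∈ Finset.range n, ∑ i, (c t i - LT1.mulVec (w t) i) * D.mulVec (w t) i
      = ∑ t ∈ Finset.range n, ∑ i, (c t i - LT.mulVec (w t) i) * D.mulVec (w t) i
        + ∑ t ∈ Finset.range n, ∑ i, (D.mulVec (w t) i) ^ 2 := by
    simp only [← Finset.sum_add_distrib]
    refine Finset.sum_congr rfl fun t _ => Finset.sum_congr rfl fun i _ => ?_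
    simp only [hD, Matrix.sub_mulVec, Pi.sub_apply]
    ring
  rw [Finset.sum_range_succ] at f1
  have key : ∑ t ∈ Finset.range n, ∑ i, (D.mulVec (w t) i) ^ 2
      = ∑ i, (c n i - LT.mulVec (w n) i) * D.mulVec (w n) i := by linarith
  have lower : μ * n * N ^ 2 ≤ ∑ t ∈ Finset.range n, ∑ i, (D.mulVec (w t) i) ^ 2 := by
    rw [Finset.sum_comm, ← hN2, Finset.mul_sum]
    refine Finset.sum_le_sum fun i _ => ?_
    have h := heig (D i)
    rw [aux_quadform, add_sub_cancel_right, one_div, inv_mul_eq_div,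
      le_div_iff₀ (by positivity)] at h
    calc _ = μ * (∑ j, D i j ^ 2) * n := by ring
      _ ≤ _ := h
  have hw2 : ∑ i, (w n i) ^ 2 ≤ B ^ 2 := (Real.sqrt_le_left hB.le).1 (hw n)
  have hc2 : ∑ i, (c n i) ^ 2 ≤ B ^ 2 := (Real.sqrt_le_left hB.le).1 (hc n)
  have hL2 : ∑ i, ∑ j, (LT i j) ^ 2 ≤ R ^ 2 := (Real.sqrt_le_left hR.le).1 hLTn
  have hLw : ∑ i, (LT.mulVec (w n) i) ^ 2 ≤ (R * B) ^ 2 := by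
    refine (aux_mulVec _ _).trans ?_
    rw [mul_pow]
    gcongr
  have hDw : ∑ i, (D.mulVec (w n) i) ^ 2 ≤ (N * B) ^ 2 := by
    refine (aux_mulVec _ _).trans ?_
    rw [mul_pow, hN2]
    gcongr
  have hr : ∑ i, (c n i - LT.mulVec (w n) i) ^ 2 ≤ (B + R * B) ^ 2 := by
    have h1 := (abs_le.1 (aux_cs (c n) (LT.mulVec (w n)) B (R * B) hB.le (by positivity) hc2 hLw)).1
    have e : ∑ i, (c n i - LT.mulVec (w n) i) ^ 2 = ∑ i, (c n i) ^ 2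
        - 2 * ∑ i, c n i * LT.mulVec (w n) i + ∑ i, (LT.mulVec (w n) i) ^ 2 := by
      simp only [Finset.mul_sum, ← Finset.sum_sub_distrib, ← Finset.sum_add_distrib]
      refine Finset.sum_congr rfl fun i _ => ?_
      ring
    rw [e]
    linarith
  have upper := (abs_le.1 (aux_cs (fun i => c n i - LT.mulVec (w n) i) (D.mulVec (w n))
    (B + R * B) (N * B) (by positivity) (by positivity) hr hDw)).2
  have main : μ * n * N ^ 2 ≤ (B + R * B) * (N * B) := by linarith
  rw [le_div_iff₀ (by positivity)]
  rcases hN0.eq_or_lt with h0 | h0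
  · rw [← h0, zero_mul]
    positivity
  · have m2 : μ * n * N ≤ B ^ 2 * (1 + R) := by
      refine le_of_mul_le_mul_right ?_ h0
      linarith
    have m3 : μ * N * 1 ≤ μ * N * n := by gcongr
    have : 0 ≤ B ^ 2 * (1 + R) := by positivity
    linarith
end
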